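/- Let a ∈ 𝔻 \ {0}, set b := −a, and let γ ∈ ℂ satisfy 0 < |γ| ≤ |a|^{3/2}. Then limsup_{ε→0, ε≠0} L^ε_{aVbV}(0, γ) ≤ 2·log|a|, where the limsup is over complex ε ≠ 0 tending to 0. -/

import Mathlib

open Complex Metric Filter Topology

noncomputable section

/-- The open unit disc in `ℂ`. -/
def unitDisc : Set ℂ := Metric.ball 0 1

/-- Extended-real logarithm, with the convention `log 0 = ⊥`. -/
def elog (x : ℝ) : EReal := if x = 0 then ⊥ else ((Real.log x : ℝ) : EReal)

/-- The Möbius involution of the unit disc exchanging `ξ` and `0`. -/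
def mobius (ξ ζ : ℂ) : ℂ := (ξ - ζ) / (1 - (starRingEnd ℂ) ξ * ζ)

/-- An analytic disc in the bidisc `𝔻²`, given by its two components. -/
def AnalyticDisc2 (φ₁ φ₂ : ℂ → ℂ) : Prop :=
  DifferentiableOn ℂ φ₁ unitDisc ∧ DifferentiableOn ℂ φ₂ unitDisc ∧
  (∀ w ∈ unitDisc, φ₁ w ∈ unitDisc) ∧ (∀ w ∈ unitDisc, φ₂ w ∈ unitDisc)

/-- The Lempert function with the two simple poles `(a,0)`, `(b,0)` in the bidisc. -/
def La0b0 (a b : ℂ) (z : ℂ × ℂ) : EReal :=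
  sInf { t : EReal | ∃ (φ₁ φ₂ : ℂ → ℂ) (ζ₁ ζ₂ : ℂ),
    AnalyticDisc2 φ₁ φ₂ ∧ ζ₁ ∈ unitDisc ∧ ζ₂ ∈ unitDisc ∧
    φ₁ 0 = z.1 ∧ φ₂ 0 = z.2 ∧
    φ₁ ζ₁ = a ∧ φ₂ ζ₁ = 0 ∧ φ₁ ζ₂ = b ∧ φ₂ ζ₂ = 0 ∧
    t = elog (‖ζ₁‖) + elog (‖ζ₂‖) }

/-- The generalized Lempert function with vertical indicator at `(a,0)` and
simple pole `(b,0)`. -/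
def LaVb0 (a b : ℂ) (z : ℂ × ℂ) : EReal :=
  sInf { t : EReal | ∃ (φ₁ φ₂ : ℂ → ℂ) (ζ₁ ζ₂ : ℂ),
    AnalyticDisc2 φ₁ φ₂ ∧ ζ₁ ∈ unitDisc ∧ ζ₂ ∈ unitDisc ∧
    φ₁ 0 = z.1 ∧ φ₂ 0 = z.2 ∧
    φ₁ ζ₁ = a ∧ φ₂ ζ₁ = 0 ∧ φ₁ ζ₂ = b ∧ φ₂ ζ₂ = 0 ∧
    deriv φ₁ ζ₁ = 0 ∧
    t = elog (‖ζ₁‖) + elog (‖ζ₁‖) + elog (‖ζ₂‖) }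

/-- The generalized Lempert function with simple pole `(a,0)` and vertical
indicator at `(b,0)`. -/
def La0bV (a b : ℂ) (z : ℂ × ℂ) : EReal :=
  sInf { t : EReal | ∃ (φ₁ φ₂ : ℂ → ℂ) (ζ₁ ζ₂ : ℂ),
    AnalyticDisc2 φ₁ φ₂ ∧ ζ₁ ∈ unitDisc ∧ ζ₂ ∈ unitDisc ∧
    φ₁ 0 = z.1 ∧ φ₂ 0 = z.2 ∧
    φ₁ ζ₁ = a ∧ φ₂ ζ₁ = 0 ∧ φ₁ ζ₂ = b ∧ φ₂ ζ₂ = 0 ∧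
    deriv φ₁ ζ₂ = 0 ∧
    t = elog (‖ζ₁‖) + elog (‖ζ₂‖) + elog (‖ζ₂‖) }

/-- The generalized Lempert function with vertical indicators at `(a,0)` and `(b,0)`. -/
def LaVbV (a b : ℂ) (z : ℂ × ℂ) : EReal :=
  sInf { t : EReal | ∃ (φ₁ φ₂ : ℂ → ℂ) (ζ₁ ζ₂ : ℂ),
    AnalyticDisc2 φ₁ φ₂ ∧ ζ₁ ∈ unitDisc ∧ ζ₂ ∈ unitDisc ∧
    φ₁ 0 = z.1 ∧ φ₂ 0 = z.2 ∧
    φ₁ ζ₁ = a ∧ φ₂ ζ₁ = 0 ∧ φ₁ ζ₂ = b ∧ φ₂ ζ₂ = 0 ∧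
    deriv φ₁ ζ₁ = 0 ∧ deriv φ₁ ζ₂ = 0 ∧
    t = elog (‖ζ₁‖) + elog (‖ζ₁‖)
        + elog (‖ζ₂‖) + elog (‖ζ₂‖) }

/-- Coman's Lempert function with the three simple poles `(a,0)`, `(b,0)`, `(b,ε)`. -/
def Leps3 (a b ε : ℂ) (z : ℂ × ℂ) : EReal :=
  sInf { t : EReal | ∃ (φ₁ φ₂ : ℂ → ℂ) (ζ₁ ζ₂ ζ₃ : ℂ),
    AnalyticDisc2 φ₁ φ₂ ∧ ζ₁ ∈ unitDisc ∧ ζ₂ ∈ unitDisc ∧ ζ₃ ∈ unitDisc ∧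
    φ₁ 0 = z.1 ∧ φ₂ 0 = z.2 ∧
    φ₁ ζ₁ = a ∧ φ₂ ζ₁ = 0 ∧ φ₁ ζ₂ = b ∧ φ₂ ζ₂ = 0 ∧ φ₁ ζ₃ = b ∧ φ₂ ζ₃ = ε ∧
    t = elog (‖ζ₁‖) + elog (‖ζ₂‖) + elog (‖ζ₃‖) }

/-- Coman's Lempert function with the four simple poles
`(a,0)`, `(b,0)`, `(b,ε)`, `(a,ε)`. -/
def Leps4 (a b ε : ℂ) (z : ℂ × ℂ) : EReal :=
  sInf { t : EReal | ∃ (φ₁ φ₂ : ℂ → ℂ) (ζ₁ ζ₂ ζ₃ ζ₄ : ℂ),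
    AnalyticDisc2 φ₁ φ₂ ∧ ζ₁ ∈ unitDisc ∧ ζ₂ ∈ unitDisc ∧ ζ₃ ∈ unitDisc ∧ ζ₄ ∈ unitDisc ∧
    φ₁ 0 = z.1 ∧ φ₂ 0 = z.2 ∧
    φ₁ ζ₁ = a ∧ φ₂ ζ₁ = 0 ∧ φ₁ ζ₂ = b ∧ φ₂ ζ₂ = 0 ∧
    φ₁ ζ₃ = b ∧ φ₂ ζ₃ = ε ∧ φ₁ ζ₄ = a ∧ φ₂ ζ₄ = ε ∧
    t = elog (‖ζ₁‖) + elog (‖ζ₂‖)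
        + elog (‖ζ₃‖) + elog (‖ζ₄‖) }

lemma mob_den {ξ ζ : ℂ} (h1 : ‖ξ‖ < 1) (h2 : ‖ζ‖ < 1) : 1 - (starRingEnd ℂ) ξ * ζ ≠ 0 := by
  intro h
  have h3 : (starRingEnd ℂ) ξ * ζ = 1 := (sub_eq_zero.mp h).symm
  have h4 : ‖ξ‖ * ‖ζ‖ = 1 := by
    rw [← RCLike.norm_conj ξ, ← norm_mul, h3, norm_one]
  nlinarith [norm_nonneg ξ, norm_nonneg ζ]

lemma mob_lt {ξ ζ : ℂ} (h1 : ‖ξ‖ < 1) (h2 : ‖ζ‖ < 1) : ‖mobius ξ ζ‖ < 1 := by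
  have hd := mob_den h1 h2
  rw [mobius, norm_div, div_lt_one (norm_pos_iff.mpr hd)]
  have e : ‖1 - (starRingEnd ℂ) ξ * ζ‖ ^ 2 - ‖ξ - ζ‖ ^ 2 = (1 - ‖ξ‖ ^ 2) * (1 - ‖ζ‖ ^ 2) := by
    simp only [← Complex.normSq_eq_norm_sq, Complex.normSq_apply]
    simp
    ring
  have h3 : 0 < (1 - ‖ξ‖ ^ 2) * (1 - ‖ζ‖ ^ 2) := by
    apply mul_pos <;> nlinarith [norm_nonneg ξ, norm_nonneg ζ]
  apply lt_of_pow_lt_pow_left₀ 2 (norm_nonneg _)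
  linarith

lemma mob_mob {ξ ζ : ℂ} (h1 : ‖ξ‖ < 1) (h2 : ‖ζ‖ < 1) : mobius ξ (mobius ξ ζ) = ζ := by
  have hd := mob_den h1 h2
  have hd' := mob_den h1 (mob_lt h1 h2)
  have hm : mobius ξ ζ * (1 - (starRingEnd ℂ) ξ * ζ) = ξ - ζ := div_mul_cancel₀ _ hd
  generalize mobius ξ ζ = m at hm hd'
  rw [mobius, div_eq_iff hd']
  linear_combination -hm

lemma mob_diff {ξ : ℂ} (h1 : ‖ξ‖ < 1) : DifferentiableOn ℂ (mobius ξ) unitDisc := by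
  unfold mobius
  apply DifferentiableOn.div
  · fun_prop
  · fun_prop
  · intro x hx
    exact mob_den h1 (by simpa [unitDisc] using hx)

lemma mem_ud {z : ℂ} : z ∈ unitDisc ↔ ‖z‖ < 1 := by simp [unitDisc]

lemma mob_zero (ξ : ℂ) : mobius ξ 0 = ξ := by simp [mobius]
lemma mob_self (ξ : ℂ) : mobius ξ ξ = 0 := by simp [mobius]

/-- the two components, in the variable `w` -/
def F1 (r : ℝ) (α p s K w : ℂ) : ℂ := r * (mobius α (w ^ 2) + K * ((w ^ 2 - s ^ 2) * (w ^ 2 - p ^ 2)))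
def F2 (A p s u k₁ k₂ k₃ w : ℂ) : ℂ :=
  (w - u) * (A * mobius (s ^ 2) (w ^ 2) + (w - s) *
    (k₁ * ((w + u) * (w - p)) + k₂ * ((w + s) * (w - p)) + k₃ * ((w + s) * (w + u))))

lemma prod_bd {x y : ℂ} (hx : ‖x‖ ≤ 2) (hy : ‖y‖ ≤ 2) (k : ℂ) : ‖k * (x * y)‖ ≤ 4 * ‖k‖ := by
  rw [norm_mul, norm_mul]
  have : ‖x‖ * ‖y‖ ≤ 2 * 2 := by gcongr
  nlinarith [norm_nonneg k]

lemma add_bd {x y : ℂ} (hx : ‖x‖ < 1) (hy : ‖y‖ < 1) : ‖x + y‖ ≤ 2 := by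
  linarith [norm_add_le x y]
lemma sub_bd {x y : ℂ} (hx : ‖x‖ < 1) (hy : ‖y‖ < 1) : ‖x - y‖ ≤ 2 := by
  linarith [norm_sub_le x y]
lemma sq_lt {x : ℂ} (hx : ‖x‖ < 1) : ‖x ^ 2‖ < 1 := by
  rw [norm_pow]; nlinarith [norm_nonneg x]

lemma F1_lt {r : ℝ} {α p s K w : ℂ} (hr : 0 < r) (hα : ‖α‖ < 1) (hp : ‖p‖ < 1) (hs : ‖s‖ < 1)
    (hw : ‖w‖ < 1) (hK : r * (1 + 4 * ‖K‖) ≤ 1) : ‖F1 r α p s K w‖ < 1 := by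
  unfold F1
  rw [norm_mul, Complex.norm_real, Real.norm_of_nonneg hr.le]
  refine lt_of_lt_of_le ?_ hK
  apply mul_lt_mul_of_pos_left _ hr
  have h1 := mob_lt hα (sq_lt hw)
  have h2 := prod_bd (sub_bd (sq_lt hw) (sq_lt hs)) (sub_bd (sq_lt hw) (sq_lt hp)) K
  linarith [norm_add_le (mobius α (w ^ 2)) (K * ((w ^ 2 - s ^ 2) * (w ^ 2 - p ^ 2)))]

lemma F2_lt {A p s u k₁ k₂ k₃ w : ℂ} (hp : ‖p‖ < 1) (hs : ‖s‖ < 1) (hu : ‖u‖ < 1)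
    (hw : ‖w‖ < 1) (hK : (1 + ‖u‖) * (‖A‖ + 8 * (‖k₁‖ + ‖k₂‖ + ‖k₃‖)) < 1) :
    ‖F2 A p s u k₁ k₂ k₃ w‖ < 1 := by
  unfold F2
  rw [norm_mul]
  refine lt_of_le_of_lt ?_ hK
  have h0 : ‖w - u‖ ≤ 1 + ‖u‖ := by linarith [norm_sub_le w u]
  refine mul_le_mul h0 ?_ (norm_nonneg _) (by positivity)
  have h1 := mob_lt (sq_lt hs) (sq_lt hw)
  have b1 := prod_bd (add_bd hw hu) (sub_bd hw hp) k₁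
  have b2 := prod_bd (add_bd hw hs) (sub_bd hw hp) k₂
  have b3 := prod_bd (add_bd hw hs) (add_bd hw hu) k₃
  have b4 := norm_add₃_le (a := k₁ * ((w + u) * (w - p))) (b := k₂ * ((w + s) * (w - p)))
    (c := k₃ * ((w + s) * (w + u)))
  refine (norm_add_le _ _).trans ?_
  have b5 : ‖A * mobius (s ^ 2) (w ^ 2)‖ ≤ ‖A‖ := by
    rw [norm_mul]; nlinarith [norm_nonneg A]
  have b6 := sub_bd hw hs
  have b7 : ‖(w - s) * (k₁ * ((w + u) * (w - p)) + k₂ * ((w + s) * (w - p)) + k₃ * ((w + s) * (w + u)))‖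
      ≤ 2 * (4 * (‖k₁‖ + ‖k₂‖ + ‖k₃‖)) := by
    rw [norm_mul]
    apply mul_le_mul b6 _ (norm_nonneg _) (by norm_num)
    linarith
  linarith

lemma diff_core {f : ℂ → ℂ} {p : ℂ} (hp : ‖p‖ < 1) (hf : DifferentiableOn ℂ f unitDisc) :
    DifferentiableOn ℂ (fun z => f (mobius p z)) unitDisc :=
  hf.comp (mob_diff hp) (fun z hz => mem_ud.2 (mob_lt hp (mem_ud.1 hz)))

lemma mob_sq_diff {α : ℂ} (hα : ‖α‖ < 1) :
    DifferentiableOn ℂ (fun w => mobius α (w ^ 2)) unitDisc :=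
  (mob_diff hα).comp (f := fun w : ℂ => w ^ 2) (by fun_prop)
    (fun z hz => mem_ud.2 (sq_lt (mem_ud.1 hz)))

lemma core (r : ℝ) (α γ p s A u ε K k₁ k₂ k₃ : ℂ) (hr : 0 < r) (hα : ‖α‖ < 1)
    (hp : ‖p‖ < 1) (hs : ‖s‖ < 1) (hu : ‖u‖ < 1) (hpα : p ^ 2 = α)
    (hsα : mobius α (s ^ 2) = -α) (hsp : mobius (s ^ 2) α = α)
    (e0 : K * ((u ^ 2 - s ^ 2) * (u ^ 2 - p ^ 2)) = α - mobius α (u ^ 2))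
    (e1 : (-s - u) * ((-s - s) * (k₁ * ((-s + u) * (-s - p)))) = ε)
    (e2 : (-u - u) * (A * mobius (s ^ 2) (u ^ 2) + (-u - s) * (k₂ * ((-u + s) * (-u - p)))) = ε)
    (e3 : (p - u) * (A * α + (p - s) * (k₃ * ((p + s) * (p + u)))) = γ)
    (b1 : r * (1 + 4 * ‖K‖) ≤ 1)
    (b2 : (1 + ‖u‖) * (‖A‖ + 8 * (‖k₁‖ + ‖k₂‖ + ‖k₃‖)) < 1) :
    Leps4 (r * α) (-(r * α)) ε (0, γ) ≤ elog ‖mobius p u‖ + elog ‖mobius p s‖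
      + elog ‖mobius p (-s)‖ + elog ‖mobius p (-u)‖ := by
  have hs' : ‖-s‖ < 1 := by simpa using hs
  have hu' : ‖-u‖ < 1 := by simpa using hu
  apply sInf_le
  refine ⟨fun z => F1 r α p s K (mobius p z), fun z => F2 A p s u k₁ k₂ k₃ (mobius p z),
    mobius p u, mobius p s, mobius p (-s), mobius p (-u), ⟨?_, ?_, ?_, ?_⟩,
    mem_ud.2 (mob_lt hp hu), mem_ud.2 (mob_lt hp hs), mem_ud.2 (mob_lt hp hs'),
    mem_ud.2 (mob_lt hp hu'), ?_, ?_, ?_, ?_, ?_, ?_, ?_, ?_, ?_, ?_, rfl⟩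
  · apply diff_core hp
    have := mob_sq_diff hα
    unfold F1
    fun_prop
  · apply diff_core hp
    have := mob_sq_diff (sq_lt hs)
    unfold F2
    fun_prop
  · exact fun w hw => mem_ud.2 (F1_lt hr hα hp hs (mob_lt hp (mem_ud.1 hw)) b1)
  · exact fun w hw => mem_ud.2 (F2_lt hp hs hu (mob_lt hp (mem_ud.1 hw)) b2)
  · simp [mob_zero, F1, hpα, mob_self]
  · simp only [mob_zero, F2, hpα, hsp]
    rw [← e3]; ring
  · simp only [mob_mob hp hu, F1, e0]; ring
  · simp [mob_mob hp hu, F2]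
  · simp [mob_mob hp hs, F1, hsα]
  · simp [mob_mob hp hs, F2, mob_self]
  · simp [mob_mob hp hs', F1, hsα]
  · simp only [mob_mob hp hs', F2, neg_sq, mob_self]
    rw [← e1]; ring
  · simp only [mob_mob hp hu', F1, neg_sq, e0]; ring
  · simp only [mob_mob hp hu', F2, neg_sq]
    rw [← e2]; ring

lemma mob_cont {ξ : ℂ} (f : ℂ → ℂ) (hf : ContinuousAt f 0) (h0 : f 0 = 0) :
    ContinuousAt (fun ε => mobius ξ (f ε)) 0 := by
  unfold mobius
  apply ContinuousAt.div
  · fun_prop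
  · fun_prop
  · simp [h0]

lemma step (r : ℝ) (α γ : ℂ) (hr : 0 < r) (hr1 : r < 1) (hα : ‖α‖ < 1) (hα0 : α ≠ 0)
    (hγ0 : γ ≠ 0) (hγ : ‖γ‖ < ‖α‖ ^ ((3 : ℝ) / 2)) :
    Filter.limsup (fun ε => Leps4 (r * α) (-(r * α)) ε (0, γ)) (𝓝[≠] (0 : ℂ))
      ≤ ((2 * Real.log ‖α‖ : ℝ) : EReal) := by
  have hn : 0 < ‖α‖ := norm_pos_iff.mpr hα0
  obtain ⟨p, hpα⟩ := IsAlgClosed.exists_pow_nat_eq α (n := 2) (by norm_num)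
  set c : ℂ := 2 * α / (1 + (starRingEnd ℂ) α * α) with hc
  have hcc : (starRingEnd ℂ) α * α = ((‖α‖ ^ 2 : ℝ) : ℂ) := by
    rw [mul_comm, Complex.mul_conj, Complex.normSq_eq_norm_sq]
  have hd1 : 1 + (starRingEnd ℂ) α * α ≠ 0 := by
    rw [hcc]; norm_cast; positivity
  have hd2 : 1 - (starRingEnd ℂ) α * α ≠ 0 := mob_den hα hα
  have hcm : c = mobius α (-α) := by
    rw [hc, mobius]; congr 1 <;> ring
  have hα' : ‖-α‖ < 1 := by simpa using hα
  have hc1 : ‖c‖ < 1 := by rw [hcm]; exact mob_lt hα hα'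
  have hc0 : c ≠ 0 := by
    rw [hc]; exact div_ne_zero (mul_ne_zero two_ne_zero hα0) hd1
  obtain ⟨s, hsc⟩ := IsAlgClosed.exists_pow_nat_eq c (n := 2) (by norm_num)
  have hsα : mobius α (s ^ 2) = -α := by rw [hsc, hcm, mob_mob hα hα']
  have hsp : mobius (s ^ 2) α = α := by
    rw [hsc]
    have := mob_den hc1 hα
    rw [mobius, div_eq_iff this, hc]
    have hd1' : 1 + α * (starRingEnd ℂ) α ≠ 0 := by rwa [mul_comm]
    simp only [map_div₀, map_mul, map_add, map_one, Complex.conj_conj, map_ofNat]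
    field_simp
    ring
  have hp : ‖p‖ < 1 := by
    have : ‖p‖ ^ 2 < 1 := by rw [← norm_pow, hpα]; exact hα
    nlinarith [norm_nonneg p]
  have hs : ‖s‖ < 1 := by
    have : ‖s‖ ^ 2 < 1 := by rw [← norm_pow, hsc]; exact hc1
    nlinarith [norm_nonneg s]
  have hp0 : p ≠ 0 := by rintro rfl; simp at hpα; exact hα0 hpα.symm
  have hs0 : s ≠ 0 := by rintro rfl; simp at hsc; exact hc0 hsc.symm
  have hpsq : s ^ 2 ≠ p ^ 2 := by
    intro h
    rw [h, hpα, mob_self] at hsα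
    exact hα0 (by simpa using hsα.symm)
  have hps : p - s ≠ 0 := by
    intro h; apply hpsq; rw [sub_eq_zero.mp h]
  have hps' : p + s ≠ 0 := by
    intro h; apply hpsq; rw [eq_neg_of_add_eq_zero_left h]; ring
  set A : ℂ := γ / (p * α) with hA
  have hA0 : A ≠ 0 := by rw [hA]; positivity
  have hpn : ‖p‖ * ‖α‖ = ‖α‖ ^ ((3 : ℝ) / 2) := by
    have h1 : ‖p‖ = ‖α‖ ^ ((1 : ℝ) / 2) := by
      rw [← hpα, norm_pow, ← Real.sqrt_eq_rpow, Real.sqrt_sq (norm_nonneg p)]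
    rw [h1]
    nth_rewrite 2 [← Real.rpow_one ‖α‖]
    rw [← Real.rpow_add hn]; norm_num
  have hA1 : ‖A‖ < 1 := by
    rw [hA, norm_div, norm_mul, hpn, div_lt_one (by positivity)]
    exact hγ
  set κ : ℂ := -1 / (2 * A * c) with hκ
  have hκ0 : κ ≠ 0 := by rw [hκ]; exact div_ne_zero (by norm_num) (mul_ne_zero (mul_ne_zero two_ne_zero hA0) hc0)
  have hκe : -2 * κ * (A * c) = 1 := by rw [hκ]; field_simp
  -- the coefficient functions
  set u : ℂ → ℂ := fun ε => κ * ε with hu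
  have cu : ContinuousAt u 0 := by fun_prop
  have u0 : u 0 = 0 := by simp [hu]
  have cu2 : ContinuousAt (fun ε => u ε ^ 2) 0 := by fun_prop
  have cm1 := mob_cont (ξ := α) _ cu2 (by simp [u0])
  have cm2 := mob_cont (ξ := s ^ 2) _ cu2 (by simp [u0])
  set K : ℂ → ℂ := fun ε => (α - mobius α (u ε ^ 2)) /
    ((u ε ^ 2 - s ^ 2) * (u ε ^ 2 - p ^ 2)) with hK
  set k₁ : ℂ → ℂ := fun ε => ε / ((-s - u ε) * ((-s - s) * ((-s + u ε) * (-s - p)))) with hk₁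
  set k₂ : ℂ → ℂ := fun ε => (A * (c - mobius (s ^ 2) (u ε ^ 2))) /
    ((-u ε - s) * ((-u ε + s) * (-u ε - p))) with hk₂
  set k₃ : ℂ → ℂ := fun ε => (γ / (p - u ε) - A * α) /
    ((p - s) * ((p + s) * (p + u ε))) with hk₃
  have hss : -s - s ≠ 0 := by
    intro h; apply hs0; linear_combination (-1 / 2) * h
  have hsp' : -s - p ≠ 0 := by
    intro h; apply hps'; linear_combination (-1) * h
  have cK : ContinuousAt K 0 := by
    apply ContinuousAt.div (by fun_prop) (by fun_prop)
    simp [u0, hp0, hs0]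
  have ck₁ : ContinuousAt k₁ 0 := by
    apply ContinuousAt.div (by fun_prop) (by fun_prop)
    simp [u0, hs0, hss, hsp']
  have ck₂ : ContinuousAt k₂ 0 := by
    apply ContinuousAt.div (by fun_prop) (by fun_prop)
    simp [u0, hs0, hp0]
  have ck₃ : ContinuousAt k₃ 0 := by
    apply ContinuousAt.div
    · apply ContinuousAt.sub _ (by fun_prop)
      apply ContinuousAt.div (by fun_prop) (by fun_prop)
      simp [u0, hp0]
    · fun_prop
    · simp [u0, hp0, hps, hps']
  have K0 : K 0 = 0 := by simp [hK, u0, mob_zero]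
  have k₁0 : k₁ 0 = 0 := by simp [hk₁]
  have k₂0 : k₂ 0 = 0 := by simp [hk₂, u0, mob_zero, hsc]
  have k₃0 : k₃ 0 = 0 := by
    have : γ / p - A * α = 0 := by rw [hA]; field_simp; ring
    simp [hk₃, u0, this]
  have ev1 : ∀ᶠ ε in 𝓝 (0 : ℂ), r * (1 + 4 * ‖K ε‖) < 1 := by
    have : ContinuousAt (fun ε => r * (1 + 4 * ‖K ε‖)) 0 := by fun_prop
    apply this.eventually_lt continuousAt_const
    simpa [K0] using hr1
  have ev2 : ∀ᶠ ε in 𝓝 (0 : ℂ),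
      (1 + ‖u ε‖) * (‖A‖ + 8 * (‖k₁ ε‖ + ‖k₂ ε‖ + ‖k₃ ε‖)) < 1 := by
    have : ContinuousAt (fun ε =>
      (1 + ‖u ε‖) * (‖A‖ + 8 * (‖k₁ ε‖ + ‖k₂ ε‖ + ‖k₃ ε‖))) 0 := by fun_prop
    apply this.eventually_lt continuousAt_const
    simpa [u0, k₁0, k₂0, k₃0] using hA1
  have ev3 : ∀ᶠ ε in 𝓝 (0 : ℂ), ‖u ε‖ < 1 := by
    apply cu.norm.eventually_lt continuousAt_const
    simp [u0]
  have ev4 : ∀ᶠ ε in 𝓝 (0 : ℂ), ‖u ε‖ < ‖p‖ := by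
    apply cu.norm.eventually_lt continuousAt_const
    simpa [u0] using hp0
  have ev5 : ∀ᶠ ε in 𝓝 (0 : ℂ), ‖u ε‖ < ‖s‖ := by
    apply cu.norm.eventually_lt continuousAt_const
    simpa [u0] using hs0
  have hs' : ‖-s‖ < 1 := by simpa using hs
  have hmm : ∀ w : ℂ, ‖w‖ < 1 → w ≠ p → mobius p w ≠ 0 := by
    intro w hw hwp
    exact div_ne_zero (sub_ne_zero.mpr hwp.symm) (mob_den hp hw)
  have hm1 : mobius p s ≠ 0 := hmm _ hs (fun h => hps (by rw [h]; ring))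
  have hm2 : mobius p (-s) ≠ 0 := hmm _ hs' (fun h => hps' (by rw [← h]; ring))
  have hprod : ‖mobius p s‖ * ‖mobius p (-s)‖ = ‖α‖ := by
    rw [← norm_mul, ← norm_neg α, ← hsα, ← hpα]
    congr 1
    have h1 := mob_den hp hs
    have h2 := mob_den hp hs'
    have h3 := mob_den (sq_lt hp) (sq_lt hs)
    unfold mobius
    rw [div_mul_div_comm, div_eq_div_iff (mul_ne_zero h1 h2) h3, map_pow]
    ring
  set f : ℂ → ℝ := fun ε => Real.log ‖mobius p (u ε)‖ + Real.log ‖mobius p s‖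
      + Real.log ‖mobius p (-s)‖ + Real.log ‖mobius p (-u ε)‖ with hf
  have cf : ContinuousAt f 0 := by
    have c1 := mob_cont (ξ := p) _ cu u0
    have c2 := mob_cont (ξ := p) (fun ε => - u ε) cu.neg (by simp [u0])
    have c3 := c1.norm.log (by simpa [u0, mob_zero] using hp0)
    have c4 := c2.norm.log (by simpa [u0, mob_zero] using hp0)
    exact ((c3.add continuousAt_const).add continuousAt_const).add c4
  have f0 : f 0 = 2 * Real.log ‖α‖ := by
    have h1 : Real.log ‖mobius p s‖ + Real.log ‖mobius p (-s)‖ = Real.log ‖α‖ := by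
      rw [← Real.log_mul (norm_ne_zero_iff.mpr hm1) (norm_ne_zero_iff.mpr hm2), hprod]
    have h2 : Real.log ‖p‖ + Real.log ‖p‖ = Real.log ‖α‖ := by
      rw [← hpα, norm_pow, Real.log_pow]; push_cast; ring
    simp only [hf, u0, neg_zero, mob_zero]
    linarith
  have key : ∀ᶠ ε in 𝓝[≠] (0 : ℂ), Leps4 (r * α) (-(r * α)) ε (0, γ) ≤ ((f ε : ℝ) : EReal) := by
    filter_upwards [nhdsWithin_le_nhds ev1, nhdsWithin_le_nhds ev2, nhdsWithin_le_nhds ev3,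
      nhdsWithin_le_nhds ev4, nhdsWithin_le_nhds ev5] with ε h1 h2 h3 h4 h5
    have nep : u ε ≠ p := by rintro h; rw [h] at h4; exact lt_irrefl _ h4
    have nep' : -u ε ≠ p := by rintro h; rw [← h, norm_neg] at h4; exact lt_irrefl _ h4
    have nes : u ε ≠ s := by rintro h; rw [h] at h5; exact lt_irrefl _ h5
    have nes' : -u ε ≠ s := by rintro h; rw [← h, norm_neg] at h5; exact lt_irrefl _ h5
    have q1 : p - u ε ≠ 0 := sub_ne_zero.mpr nep.symm
    have q2 : p + u ε ≠ 0 := fun h => nep' (by linear_combination -h)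
    have q3 : -u ε - p ≠ 0 := sub_ne_zero.mpr nep'
    have q4 : -u ε - s ≠ 0 := sub_ne_zero.mpr nes'
    have q5 : -u ε + s ≠ 0 := fun h => nes (by linear_combination -h)
    have q6 : -s - u ε ≠ 0 := fun h => q4 (by linear_combination h)
    have q7 : -s + u ε ≠ 0 := fun h => nes (by linear_combination h)
    have q8 : u ε ^ 2 - s ^ 2 ≠ 0 := by
      have : u ε ^ 2 - s ^ 2 = (-u ε - s) * (-u ε + s) := by ring
      rw [this]; exact mul_ne_zero q4 q5
    have q9 : u ε ^ 2 - p ^ 2 ≠ 0 := by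
      have : u ε ^ 2 - p ^ 2 = (-u ε - p) * (p - u ε) := by ring
      rw [this]; exact mul_ne_zero q3 q1
    have h3' : ‖-u ε‖ < 1 := by simpa using h3
    have C := core r α γ p s A (u ε) ε (K ε) (k₁ ε) (k₂ ε) (k₃ ε) hr hα hp hs h3 hpα hsα hsp
      (div_mul_cancel₀ _ (mul_ne_zero q8 q9))
      (by
        have : k₁ ε * ((-s - u ε) * ((-s - s) * ((-s + u ε) * (-s - p)))) = ε :=
          div_mul_cancel₀ _ (by simp only [ne_eq, mul_eq_zero]; tauto)
        linear_combination this)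
      (by
        have : k₂ ε * ((-u ε - s) * ((-u ε + s) * (-u ε - p)))
            = A * (c - mobius (s ^ 2) (u ε ^ 2)) :=
          div_mul_cancel₀ _ (by simp only [ne_eq, mul_eq_zero]; tauto)
        have hue : u ε = κ * ε := rfl
        linear_combination (-u ε - u ε) * this + ε * hκe - 2 * A * c * hue)
      (by
        have : k₃ ε * ((p - s) * ((p + s) * (p + u ε))) = γ / (p - u ε) - A * α :=
          div_mul_cancel₀ _ (by simp only [ne_eq, mul_eq_zero]; tauto)
        have h : γ / (p - u ε) * (p - u ε) = γ := div_mul_cancel₀ _ q1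
        linear_combination (p - u ε) * this + h)
      h1.le h2
    refine C.trans (le_of_eq ?_)
    have E : ∀ w : ℂ, w ≠ 0 → elog ‖w‖ = ((Real.log ‖w‖ : ℝ) : EReal) := by
      intro w hw
      simp [elog, hw]
    rw [E _ (hmm _ h3 nep), E _ hm1, E _ hm2, E _ (hmm _ h3' nep')]
    simp only [hf, EReal.coe_add]
  have lim : Tendsto (fun ε => ((f ε : ℝ) : EReal)) (𝓝[≠] (0 : ℂ))
      (𝓝 ((2 * Real.log ‖α‖ : ℝ) : EReal)) := by
    rw [← f0]
    exact ((continuous_coe_real_ereal.tendsto _).comp cf.tendsto).mono_left nhdsWithin_le_nhds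
  rw [← lim.limsup_eq]
  exact limsup_le_limsup key

/-- Step 2 of Theorem `limell4<ltilde`: with `b = -a` and `0 < |γ| ≤ |a|^{3/2}`,
`limsup_{ε→0, ε≠0} L^ε_{aVbV}(0,γ) ≤ 2 log|a|`. -/
theorem limsup_Leps4_le_green
    (a γ : ℂ) (ha : a ∈ unitDisc) (ha0 : a ≠ 0) (hγ0 : γ ≠ 0)
    (hγ : ‖γ‖ ≤ (‖a‖) ^ ((3 : ℝ) / 2)) :
    Filter.limsup (fun ε => Leps4 a (-a) ε (0, γ)) (𝓝[≠] (0 : ℂ))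
      ≤ ((2 * Real.log (‖a‖) : ℝ) : EReal) := by
  have ha1 : ‖a‖ < 1 := mem_ud.1 ha
  have hn : 0 < ‖a‖ := norm_pos_iff.mpr ha0
  have main : ∀ r : ℝ, ‖a‖ < r → r < 1 →
      Filter.limsup (fun ε => Leps4 a (-a) ε (0, γ)) (𝓝[≠] (0 : ℂ))
      ≤ ((2 * Real.log (‖a‖ / r) : ℝ) : EReal) := by
    intro r h1 h2
    have hr : 0 < r := hn.trans h1
    have hrc : (r : ℂ) ≠ 0 := by exact_mod_cast hr.ne'
    have hnorm : ‖a / r‖ = ‖a‖ / r := by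
      rw [norm_div, Complex.norm_real, Real.norm_of_nonneg hr.le]
    have h := step r (a / r) γ hr h2 (by rw [hnorm, div_lt_one hr]; exact h1)
      (div_ne_zero ha0 hrc) hγ0 (by
        rw [hnorm]
        refine lt_of_le_of_lt hγ (Real.rpow_lt_rpow hn.le ?_ (by norm_num))
        rw [lt_div_iff₀ hr]; nlinarith)
    rw [hnorm, mul_div_cancel₀ _ hrc] at h
    exact h
  have lim : Tendsto (fun r : ℝ => ((2 * Real.log (‖a‖ / r) : ℝ) : EReal)) (𝓝[<] (1 : ℝ))
      (𝓝 ((2 * Real.log (‖a‖) : ℝ) : EReal)) := by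
    have c : ContinuousAt (fun r : ℝ => 2 * Real.log (‖a‖ / r)) 1 := by
      have c1 : ContinuousAt (fun r : ℝ => ‖a‖ / r) 1 :=
        continuousAt_const.div continuousAt_id one_ne_zero
      exact continuousAt_const.mul (c1.log (by simpa using ha0))
    have := (continuous_coe_real_ereal.tendsto _).comp c.tendsto
    simp only [div_one] at this
    exact this.mono_left nhdsWithin_le_nhds
  refine ge_of_tendsto lim ?_
  filter_upwards [Ioo_mem_nhdsLT ha1] with r hr
  exact main r hr.1 hr.2
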